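/- arXiv:1805.10715 — 2 statements merged into one kernel-verified Lean document; each statement's English description precedes it below -/
import Mathlib

section
/- For every positive integer $k$, $\rho(k) = O_\varepsilon(k^{3+\varepsilon})$ for any $\varepsilon > 0$, where $\rho(k)$ is the number of solutions $(x_1,x_2,y_1,y_2) \in (\mathbb{Z}/k\mathbb{Z})^4$ of $x_1 y_1^2 \equiv x_2 y_2^2 \pmod{k}$. -/
/-- `rho k` is the number of quadruples `(x₁, x₂, y₁, y₂) ∈ (ℤ/kℤ)⁴` with
`x₁ y₁² = x₂ y₂²`. -/
noncomputable def rho (k : ℕ) : ℕ :=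
  Nat.card {q : ZMod k × ZMod k × ZMod k × ZMod k //
    q.1 * q.2.2.1 ^ 2 = q.2.1 * q.2.2.2 ^ 2}

/-- For each `d ≠ 0` there is `r ∣ d` with `d ≤ r²` such that `d ∣ y²` forces `r ∣ y`. -/
theorem exists_dvd_forall_dvd_of_dvd_sq {d : ℕ} (hd : d ≠ 0) :
    ∃ r, r ∣ d ∧ d ≤ r ^ 2 ∧ ∀ y : ℕ, d ∣ y ^ 2 → r ∣ y := by
  obtain ⟨a, b, rfl, ha⟩ := Nat.sq_mul_squarefree d
  have ha0 : 0 < a := Nat.pos_of_ne_zero ha.ne_zero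
  refine ⟨b * a, ⟨b, by ring⟩, ?_, fun y hy => ?_⟩
  · rw [mul_pow]
    exact Nat.mul_le_mul_left _ (Nat.le_self_pow two_ne_zero a)
  · obtain ⟨z, rfl⟩ : b ∣ y := (Nat.pow_dvd_pow_iff two_ne_zero).1 ((Dvd.intro _ rfl).trans hy)
    have hb : 0 < b ^ 2 := Nat.pos_of_ne_zero (left_ne_zero_of_mul hd)
    rw [mul_pow] at hy
    exact Nat.mul_dvd_mul_left _
      ((ha.dvd_pow_iff_dvd two_ne_zero).1 (Nat.dvd_of_mul_dvd_mul_left hb hy))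

theorem mul_card_dvd_sq_le {k d : ℕ} [NeZero k] (hd : d ∣ k) :
    d * (Finset.univ.filter fun y : ZMod k => d ∣ y.val ^ 2).card ^ 2 ≤ k ^ 2 := by
  have hd0 : d ≠ 0 := ne_zero_of_dvd_ne_zero (NeZero.ne k) hd
  obtain ⟨r, hrd, hle, hr⟩ := exists_dvd_forall_dvd_of_dvd_sq hd0
  have hrk := hrd.trans hd
  have hcard : (Finset.univ.filter fun y : ZMod k => d ∣ y.val ^ 2).card ≤ k / r := by
    rw [← Finset.card_range (k / r)]
    refine Finset.card_le_card_of_injOn (fun y => y.val / r) (fun y _ => ?_) ?_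
    · simpa using Nat.div_lt_div_of_lt_of_dvd hrk (ZMod.val_lt y)
    · intro y hy z hz h
      simp only [Finset.coe_filter, Finset.mem_univ, true_and, Set.mem_ofPred_eq] at hy hz
      exact ZMod.val_injective k ((Nat.div_left_inj (hr _ hy) (hr _ hz)).1 h)
  calc _ ≤ r ^ 2 * (k / r) ^ 2 := by gcongr
    _ = k ^ 2 := by rw [← mul_pow, Nat.mul_div_cancel' hrk]

theorem card_mul_eq_mul_le {k : ℕ} [NeZero k] (a b : ℕ) :
    Nat.card {x : ZMod k × ZMod k // x.1 * (a : ZMod k) = x.2 * (b : ZMod k)} ≤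
      k * (a.gcd b).gcd k := by
  set g := (a.gcd b).gcd k
  have hk : 0 < k := NeZero.pos k
  have hgk : g ∣ k := Nat.gcd_dvd_right _ _
  have hg0 : 0 < g := Nat.pos_of_dvd_of_pos hgk hk
  let f : ZMod k × ZMod k →+ ZMod k :=
    (AddMonoidHom.mulRight (a : ZMod k)).comp (AddMonoidHom.fst _ _) -
      (AddMonoidHom.mulRight (b : ZMod k)).comp (AddMonoidHom.snd _ _)
  have hf : ∀ x, f x = x.1 * (a : ZMod k) - x.2 * (b : ZMod k) := fun _ => rfl
  have hmem : (g : ZMod k) ∈ f.range := by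
    have h₁ : ((g : ℤ) : ZMod k) = _ :=
      congrArg (Int.cast : ℤ → ZMod k) (Nat.gcd_eq_gcd_ab (a.gcd b) k)
    have h₂ : (((a.gcd b : ℕ) : ℤ) : ZMod k) = _ :=
      congrArg (Int.cast : ℤ → ZMod k) (Nat.gcd_eq_gcd_ab a b)
    push_cast at h₁ h₂
    simp only [CharP.cast_eq_zero, zero_mul, add_zero] at h₁
    refine ⟨((a.gcdA b : ZMod k) * ((a.gcd b).gcdA k : ZMod k),
      -((a.gcdB b : ZMod k) * ((a.gcd b).gcdA k : ZMod k))), ?_⟩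
    rw [hf, h₁, h₂]
    ring
  have hrange : k / g ≤ Nat.card f.range := by
    have h : addOrderOf (g : ZMod k) = k / g := by
      rw [ZMod.addOrderOf_coe _ hk.ne', Nat.gcd_eq_right hgk]
    rw [← h, ← Nat.card_zmultiples]
    exact AddSubgroup.card_le_of_le (AddSubgroup.zmultiples_le_of_mem hmem)
  have hker : Nat.card {x : ZMod k × ZMod k // x.1 * (a : ZMod k) = x.2 * (b : ZMod k)} =
      Nat.card f.ker :=
    Nat.card_congr (Equiv.subtypeEquivRight fun x => by
      rw [AddMonoidHom.mem_ker, hf, sub_eq_zero])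
  have hprod : Nat.card f.ker * Nat.card f.range = k * k := by
    rw [← AddSubgroup.index_ker, AddSubgroup.card_mul_index, Nat.card_prod, Nat.card_zmod]
  rw [hker]
  refine Nat.le_of_mul_le_mul_right ?_ (Nat.div_pos (Nat.le_of_dvd hk hgk) hg0)
  calc Nat.card f.ker * (k / g) ≤ k * k := hprod ▸ Nat.mul_le_mul_left _ hrange
    _ = k * g * (k / g) := by rw [mul_assoc, Nat.mul_div_cancel' hgk]

theorem rho_eq_sum (k : ℕ) [NeZero k] :
    rho k = ∑ y : ZMod k × ZMod k,
      Nat.card {x : ZMod k × ZMod k // x.1 * y.1 ^ 2 = x.2 * y.2 ^ 2} := by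
  rw [rho, ← Nat.card_sigma]
  exact Nat.card_congr
    { toFun := fun q => ⟨(q.1.2.2.1, q.1.2.2.2), ⟨(q.1.1, q.1.2.1), q.2⟩⟩
      invFun := fun s => ⟨(s.2.1.1, s.2.1.2, s.1.1, s.1.2), s.2.2⟩
      left_inv := fun _ => rfl
      right_inv := fun _ => rfl }

theorem sum_gcd_sq_le (k : ℕ) [NeZero k] :
    ∑ y : ZMod k × ZMod k, ((y.1.val ^ 2).gcd (y.2.val ^ 2)).gcd k ≤
      k.divisors.card * k ^ 2 := by
  have hk : k ≠ 0 := NeZero.ne k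
  calc _ ≤ ∑ y : ZMod k × ZMod k, ∑ d ∈ k.divisors,
        if d ∣ y.1.val ^ 2 ∧ d ∣ y.2.val ^ 2 then d else 0 := by
        refine Finset.sum_le_sum fun y _ => ?_
        set g := ((y.1.val ^ 2).gcd (y.2.val ^ 2)).gcd k
        have hg₁ : g ∣ (y.1.val ^ 2).gcd (y.2.val ^ 2) := Nat.gcd_dvd_left _ _
        have h := Finset.single_le_sum
          (f := fun d => if d ∣ y.1.val ^ 2 ∧ d ∣ y.2.val ^ 2 then d else 0)
          (fun _ _ => Nat.zero_le _) (Nat.mem_divisors.2 ⟨Nat.gcd_dvd_right _ _, hk⟩ : g ∈ _)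
        simpa only [if_pos (Nat.dvd_gcd_iff.1 hg₁)] using h
    _ = ∑ d ∈ k.divisors,
        d * (Finset.univ.filter fun y : ZMod k => d ∣ y.val ^ 2).card ^ 2 := by
        rw [Finset.sum_comm]
        refine Finset.sum_congr rfl fun d _ => ?_
        rw [← Finset.sum_filter, Finset.sum_const, smul_eq_mul, mul_comm, sq,
          ← Finset.card_product, ← Finset.filter_product, Finset.univ_product_univ]
    _ ≤ ∑ d ∈ k.divisors, k ^ 2 :=
        Finset.sum_le_sum fun d hd => mul_card_dvd_sq_le (Nat.dvd_of_mem_divisors hd)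
    _ = k.divisors.card * k ^ 2 := by rw [Finset.sum_const, smul_eq_mul]

theorem rho_le_card_divisors_mul (k : ℕ) [NeZero k] : rho k ≤ k.divisors.card * k ^ 3 := by
  calc rho k ≤ ∑ y : ZMod k × ZMod k, k * ((y.1.val ^ 2).gcd (y.2.val ^ 2)).gcd k := by
        rw [rho_eq_sum]
        refine Finset.sum_le_sum fun y _ => ?_
        have hcast : ∀ z : ZMod k, ((z.val ^ 2 : ℕ) : ZMod k) = z ^ 2 := fun z => by simp
        have h := card_mul_eq_mul_le (k := k) (y.1.val ^ 2) (y.2.val ^ 2)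
        rwa [hcast, hcast] at h
    _ ≤ k * (k.divisors.card * k ^ 2) := by
        rw [← Finset.mul_sum]
        exact Nat.mul_le_mul_left _ (sum_gcd_sq_le k)
    _ = k.divisors.card * k ^ 3 := by ring

/-- The divisor bound `τ(n) = O_ε(n ^ ε)`. -/
theorem exists_card_divisors_le_mul_rpow (ε : ℝ) (hε : 0 < ε) :
    ∃ C : ℝ, 0 < C ∧ ∀ n : ℕ, n ≠ 0 → (n.divisors.card : ℝ) ≤ C * (n : ℝ) ^ ε := by
  obtain ⟨M, hM⟩ := exists_nat_ge ((2 : ℝ) ^ (1 / ε))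
  have hlog : 0 < ε * Real.log 2 := mul_pos hε (Real.log_pos one_lt_two)
  set B : ℝ := 1 + 1 / (ε * Real.log 2) with hB
  have hB1 : 1 ≤ B := le_add_of_nonneg_right (by positivity)
  have hlarge : ∀ p a : ℕ, M ≤ p → (a + 1 : ℝ) ≤ ((p : ℝ) ^ ε) ^ a := by
    intro p a hp
    have h2 : (2 : ℝ) ≤ (p : ℝ) ^ ε := by
      calc (2 : ℝ) = ((2 : ℝ) ^ (1 / ε)) ^ ε := by
            rw [← Real.rpow_mul two_pos.le, one_div_mul_cancel hε.ne', Real.rpow_one]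
        _ ≤ (p : ℝ) ^ ε := by
            have : (M : ℝ) ≤ p := by exact_mod_cast hp
            exact Real.rpow_le_rpow (by positivity) (hM.trans this) hε.le
    calc (a + 1 : ℝ) ≤ 2 ^ a := by exact_mod_cast Nat.lt_two_pow_self
      _ ≤ _ := by gcongr
  have hsmall : ∀ p a : ℕ, 2 ≤ p → (a + 1 : ℝ) ≤ B * ((p : ℝ) ^ ε) ^ a := by
    intro p a hp
    have hp' : (2 : ℝ) ≤ p := by exact_mod_cast hp
    have hexp : 1 + a * (ε * Real.log 2) ≤ ((2 : ℝ) ^ ε) ^ a := by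
      rw [Real.rpow_def_of_pos two_pos, ← Real.exp_nat_mul]
      have := Real.add_one_le_exp (a * (Real.log 2 * ε))
      linarith
    calc (a + 1 : ℝ) ≤ B * (1 + a * (ε * Real.log 2)) := by
          have : B * (1 + a * (ε * Real.log 2)) =
              a + 1 + 1 / (ε * Real.log 2) + a * (ε * Real.log 2) := by
            rw [hB]
            field_simp
            ring
          rw [this]
          have h₁ : 0 ≤ 1 / (ε * Real.log 2) := by positivity
          have h₂ : 0 ≤ a * (ε * Real.log 2) := by positivity
          linarith
      _ ≤ B * ((2 : ℝ) ^ ε) ^ a := by gcongr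
      _ ≤ B * ((p : ℝ) ^ ε) ^ a := by gcongr
  refine ⟨B ^ M, by positivity, fun n hn => ?_⟩
  have hpow : (n : ℝ) ^ ε = ∏ p ∈ n.primeFactors, ((p : ℝ) ^ ε) ^ n.factorization p := by
    conv_lhs => rw [← Nat.prod_factorization_pow_eq_self hn, Finsupp.prod]
    push_cast
    rw [← Real.finsetProd_rpow _ _ fun p _ => by positivity]
    refine Finset.prod_congr rfl fun p _ => ?_
    rw [← Real.rpow_natCast_mul p.cast_nonneg, ← Real.rpow_mul_natCast p.cast_nonneg, mul_comm]
  have hconst : ∏ p ∈ n.primeFactors, (if p < M then B else 1) ≤ B ^ M := by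
    rw [← Finset.prod_filter, Finset.prod_const]
    refine pow_le_pow_right₀ hB1 ?_
    calc _ ≤ (Finset.range M).card := Finset.card_le_card fun p hp => by
          simpa using (Finset.mem_filter.1 hp).2
      _ = M := Finset.card_range M
  calc (n.divisors.card : ℝ) = ∏ p ∈ n.primeFactors, (n.factorization p + 1 : ℝ) := by
        rw [Nat.card_divisors hn]
        push_cast
        rfl
    _ ≤ ∏ p ∈ n.primeFactors, (if p < M then B else 1) * ((p : ℝ) ^ ε) ^ n.factorization p := by
        refine Finset.prod_le_prod (fun p _ => by positivity) fun p hp => ?_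
        split_ifs with h
        · exact hsmall p _ (Nat.prime_of_mem_primeFactors hp).two_le
        · simpa using hlarge p _ (not_lt.1 h)
    _ ≤ B ^ M * (n : ℝ) ^ ε := by
        rw [Finset.prod_mul_distrib, ← hpow]
        gcongr

theorem stmt_3 (ε : ℝ) (hε : 0 < ε) :
    ∃ C : ℝ, 0 < C ∧ ∀ k : ℕ, 1 ≤ k → (rho k : ℝ) ≤ C * (k : ℝ) ^ ((3 : ℝ) + ε) := by
  obtain ⟨C, hC, h⟩ := exists_card_divisors_le_mul_rpow ε hε
  refine ⟨C, hC, fun k hk => ?_⟩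
  have hk0 : k ≠ 0 := Nat.one_le_iff_ne_zero.1 hk
  have : NeZero k := ⟨hk0⟩
  have hkpos : (0 : ℝ) < k := by exact_mod_cast hk
  calc (rho k : ℝ) ≤ k.divisors.card * (k : ℝ) ^ 3 := by
        exact_mod_cast rho_le_card_divisors_mul k
    _ ≤ C * (k : ℝ) ^ ε * (k : ℝ) ^ 3 := by
        gcongr
        exact h k hk0
    _ = C * (k : ℝ) ^ ((3 : ℝ) + ε) := by
        rw [Real.rpow_add hkpos, mul_assoc, mul_comm ((k : ℝ) ^ ε)]
        norm_cast
end

section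
/- Let $F(\mathbf{x}) = \sum_{i=1}^4 A_i x_i^2$ with $\Delta_F = A_1 A_2 A_3 A_4 \neq 0$, and let $p$ be a prime with $p \nmid 2\Delta_F$. Then for every $r \geq 1$ and $\mathbf{c} \in \mathbb{Z}^4$, $S_{p^r}(\mathbf{c}) = \left(\frac{\Delta_F}{p^r}\right) p^{2r} c_{p^r}(F^*(\mathbf{c}))$, where $c_{p^r}$ is the Ramanujan sum and $F^*(\mathbf{y}) = A_2A_3A_4 y_1^2 + A_1A_3A_4 y_2^2 + A_1A_2A_4 y_3^2 + A_1A_2A_3 y_4^2$ is the dual form. -/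
/-- `e_q(t) = exp(2πit/q)`. -/
noncomputable def eq' (q : ℕ) (t : ℤ) : ℂ :=
  Complex.exp (2 * Real.pi * Complex.I * (t : ℂ) / (q : ℂ))

/-- The complete exponential sum `S_q(c)` attached to the diagonal quadratic form
`F(x) = ∑ A i * x i ^ 2`. -/
noncomputable def Sq (A c : Fin 4 → ℤ) (q : ℕ) : ℂ :=
  ∑ a ∈ (Finset.range q).filter (fun a => Nat.gcd a q = 1),
    ∑ b ∈ Fintype.piFinset (fun _ : Fin 4 => Finset.range q),
      eq' q ((a : ℤ) * (∑ i, A i * ((b i : ℤ)) ^ 2) + ∑ i, (b i : ℤ) * c i)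

/-- The Ramanujan sum `c_q(N) = ∑*_{a mod q} e_q(aN)`. -/
noncomputable def ramanujanC (q : ℕ) (N : ℤ) : ℂ :=
  ∑ a ∈ (Finset.range q).filter (fun a => Nat.gcd a q = 1), eq' q ((a : ℤ) * N)

open Finset

theorem eq'_eq_stdAddChar (q : ℕ) [NeZero q] (t : ℤ) :
    eq' q t = ZMod.stdAddChar (t : ZMod q) := by
  rw [ZMod.stdAddChar_coe, eq']

theorem eq'_add (q : ℕ) (s t : ℤ) : eq' q (s + t) = eq' q s * eq' q t := by
  rw [eq', eq', eq', ← Complex.exp_add]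
  congr 1
  push_cast
  ring

theorem eq'_mul_left {m : ℕ} (hm : m ≠ 0) (q : ℕ) (t : ℤ) : eq' (m * q) (m * t) = eq' q t := by
  have hm' : (m : ℂ) ≠ 0 := Nat.cast_ne_zero.mpr hm
  rw [eq', eq']
  congr 1
  push_cast
  rw [mul_left_comm, mul_div_mul_left _ _ hm']

theorem sum_range_natCast_zmod (q : ℕ) [NeZero q] (f : ZMod q → ℂ) :
    ∑ x ∈ range q, f x = ∑ x : ZMod q, f x := by
  refine Finset.sum_nbij' (fun x : ℕ => (x : ZMod q)) ZMod.val (by simp) ?_ ?_ (by simp) (by simp)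
  · intro x _
    exact mem_range.mpr (ZMod.val_lt x)
  · intro x hx
    exact ZMod.val_cast_of_lt (mem_range.mp hx)

theorem sum_coprime_natCast_zmod (q : ℕ) [NeZero q] (f : ZMod q → ℂ) :
    ∑ a ∈ (range q).filter (fun a => Nat.gcd a q = 1), f a = ∑ u : (ZMod q)ˣ, f u := by
  refine Finset.sum_bij' (fun a ha => ZMod.unitOfCoprime a (mem_filter.mp ha).2)
    (fun u _ => (u : ZMod q).val) (by simp) ?_ ?_ ?_ ?_
  · intro u _
    exact mem_filter.mpr ⟨mem_range.mpr (ZMod.val_lt _), ZMod.val_coe_unit_coprime u⟩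
  · intro a ha
    simpa using ZMod.val_cast_of_lt (mem_range.mp (mem_filter.mp ha).1)
  · intro u _
    ext
    simp
  · intro a ha
    simp

theorem sum_range_mul_eq (f : ℕ → ℂ) (m n : ℕ) :
    ∑ x ∈ range (m * n), f x = ∑ z ∈ range n, ∑ y ∈ range m, f (y + m * z) := by
  induction n with
  | zero => simp
  | succ n ih =>
    rw [Nat.mul_succ, sum_range_add, ih, sum_range_succ]
    simp only [add_comm]

/-- The quadratic Gauss sum `∑ x mod q, e_q(u x²)`. -/
noncomputable def quadGauss (q : ℕ) (u : ℤ) : ℂ := ∑ x ∈ range q, eq' q (u * (x : ℤ) ^ 2)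

theorem quadGauss_eq_sum_zmod (q : ℕ) [NeZero q] (u : ℤ) :
    quadGauss q u = ∑ x : ZMod q, ZMod.stdAddChar ((u : ZMod q) * x ^ 2) := by
  rw [quadGauss, ← sum_range_natCast_zmod]
  simp [eq'_eq_stdAddChar]

theorem sum_eq'_mul_prime {p : ℕ} (hp : p.Prime) (t : ℤ) :
    ∑ z ∈ range p, eq' p (t * z) = if (p : ℤ) ∣ t then (p : ℂ) else 0 := by
  have : Fact p.Prime := ⟨hp⟩
  have h := AddChar.sum_mulShift (t : ZMod p) (ZMod.isPrimitive_stdAddChar p)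
  rw [← sum_range_natCast_zmod p (fun x => ZMod.stdAddChar (x * (t : ZMod p)))] at h
  simp only [eq'_eq_stdAddChar, Int.cast_mul, Int.cast_natCast, mul_comm (t : ZMod p), h,
    ZMod.intCast_zmod_eq_zero_iff_dvd, ZMod.card]
  simp

theorem quadGauss_prime_pow_add_two {p : ℕ} (hp : p.Prime) {u : ℤ} (hu : ¬ (p : ℤ) ∣ 2 * u)
    (r : ℕ) : quadGauss (p ^ (r + 2)) u = p * quadGauss (p ^ r) u := by
  have hpZ : Prime (p : ℤ) := Nat.prime_iff_prime_int.mp hp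
  have : NeZero (p ^ (r + 2)) := ⟨pow_ne_zero _ hp.ne_zero⟩
  have term (y z : ℕ) : eq' (p ^ (r + 2)) (u * ((y + p ^ (r + 1) * z : ℕ) : ℤ) ^ 2) =
      eq' (p ^ (r + 2)) (u * (y : ℤ) ^ 2) * eq' p (2 * u * y * z) := by
    rw [← eq'_mul_left (pow_ne_zero (r + 1) hp.ne_zero) p, ← pow_succ, ← eq'_add,
      eq'_eq_stdAddChar, eq'_eq_stdAddChar]
    congr 1
    rw [← sub_eq_zero, ← Int.cast_sub, ZMod.intCast_zmod_eq_zero_iff_dvd]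
    refine ⟨u * (p : ℤ) ^ r * z ^ 2, ?_⟩
    push_cast
    ring
  have inner (y : ℕ) : ∑ z ∈ range p, eq' p (2 * u * y * z) = if p ∣ y then (p : ℂ) else 0 := by
    rw [sum_eq'_mul_prime hp]
    simp only [hpZ.dvd_mul (a := 2 * u), hu, false_or, Int.natCast_dvd_natCast]
  have split : quadGauss (p ^ (r + 2)) u = ∑ y ∈ range (p * p ^ r),
      eq' (p ^ (r + 2)) (u * (y : ℤ) ^ 2) * if p ∣ y then (p : ℂ) else 0 := by
    rw [quadGauss]
    conv_lhs => rw [pow_succ p (r + 1), sum_range_mul_eq, sum_comm, ← pow_succ p (r + 1)]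
    rw [← pow_succ']
    refine sum_congr rfl fun y _ => ?_
    rw [← inner, mul_sum]
    exact sum_congr rfl fun z _ => term y z
  rw [split, sum_range_mul_eq, quadGauss, mul_sum]
  refine sum_congr rfl fun w _ => ?_
  rw [sum_eq_single 0]
  · rw [if_pos (by simp), mul_comm]
    congr 1
    rw [← eq'_mul_left (pow_ne_zero 2 hp.ne_zero) (p ^ r), ← pow_add, add_comm 2 r]
    congr 1
    push_cast
    ring
  · intro y hy hy0
    rw [if_neg, mul_zero]
    rw [← Nat.dvd_add_iff_left (dvd_mul_right p w)]
    exact Nat.not_dvd_of_pos_of_lt (Nat.pos_of_ne_zero hy0) (mem_range.mp hy)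
  · intro h
    exact absurd (mem_range.mpr hp.pos) h

/-- The complex-valued quadratic character modulo a prime. -/
noncomputable def complexQuadraticChar (p : ℕ) [Fact p.Prime] : MulChar (ZMod p) ℂ :=
  (quadraticChar (ZMod p)).ringHomComp (Int.castRingHom ℂ)

theorem quadGauss_prime (p : ℕ) [Fact p.Prime] (hp2 : p ≠ 2) {u : ℤ} (hu : (u : ZMod p) ≠ 0) :
    quadGauss p u = jacobiSym u p * gaussSum (complexQuadraticChar p) ZMod.stdAddChar := by
  have hchar : ringChar (ZMod p) ≠ 2 := by rwa [ZMod.ringChar_zmod_n]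
  have hcount (t : ZMod p) : ((univ.filter fun x : ZMod p => x ^ 2 = t).card : ℂ) =
      complexQuadraticChar p t + 1 := by
    have h := quadraticChar_card_sqrts hchar t
    have h' : (univ.filter fun x : ZMod p => x ^ 2 = t) = {x : ZMod p | x ^ 2 = t}.toFinset := by
      ext; simp
    rw [h', complexQuadraticChar, MulChar.ringHomComp_apply]
    simpa using congrArg (Int.cast : ℤ → ℂ) h
  have hprim := ZMod.isPrimitive_stdAddChar p
  have hsum : quadGauss p u =
      gaussSum (complexQuadraticChar p) (AddChar.mulShift ZMod.stdAddChar (u : ZMod p)) := by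
    rw [quadGauss_eq_sum_zmod, ← sum_fiberwise (s := univ) (g := fun x : ZMod p => x ^ 2)]
    have hfib (t : ZMod p) : ∑ x ∈ univ.filter (fun x : ZMod p => x ^ 2 = t),
        (ZMod.stdAddChar ((u : ZMod p) * x ^ 2) : ℂ) =
        complexQuadraticChar p t * AddChar.mulShift ZMod.stdAddChar (u : ZMod p) t +
          ZMod.stdAddChar (t * (u : ZMod p)) := by
      rw [sum_congr rfl (g := fun _ => (ZMod.stdAddChar ((u : ZMod p) * t) : ℂ))
        (fun x hx => by rw [(mem_filter.mp hx).2]), sum_const, nsmul_eq_mul, hcount,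
        AddChar.mulShift_apply, mul_comm t]
      ring
    simp only [hfib]
    rw [sum_add_distrib, AddChar.sum_mulShift _ hprim, if_neg hu, gaussSum]
    simp
  have hquad : complexQuadraticChar p (u : ZMod p) = jacobiSym u p := by
    rw [← jacobiSym.legendreSym.to_jacobiSym]
    simp [complexQuadraticChar, legendreSym]
  have hsq : (jacobiSym u p : ℂ) * jacobiSym u p = 1 := by
    rw [← jacobiSym.legendreSym.to_jacobiSym]
    exact_mod_cast (sq (legendreSym p u)).symm.trans (legendreSym.sq_one p hu)
  rw [hsum, ← gaussSum_mulShift (complexQuadraticChar p) ZMod.stdAddChar (Units.mk0 _ hu),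
    Units.val_mk0, hquad, ← mul_assoc, hsq, one_mul]

theorem gaussSum_complexQuadraticChar_pow_four (p : ℕ) [Fact p.Prime] (hp2 : p ≠ 2) :
    gaussSum (complexQuadraticChar p) ZMod.stdAddChar ^ 4 = (p : ℂ) ^ 2 := by
  have hchar : ringChar (ZMod p) ≠ 2 := by rwa [ZMod.ringChar_zmod_n]
  have hne : complexQuadraticChar p ≠ 1 :=
    (MulChar.ringHomComp_ne_one_iff (RingHom.injective_int _)).mpr (quadraticChar_ne_one hchar)
  have hquad : (complexQuadraticChar p).IsQuadratic := (quadraticChar_isQuadratic _).comp _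
  have h := gaussSum_sq hne hquad (ZMod.isPrimitive_stdAddChar p)
  rw [show 4 = 2 * 2 from rfl, pow_mul, h, mul_pow, ZMod.card, ← map_pow]
  simp

theorem quadGauss_prime_pow {p : ℕ} (hp : p.Prime) {u : ℤ} (hu : ¬ (p : ℤ) ∣ 2 * u) (r : ℕ) :
    quadGauss (p ^ r) u = jacobiSym u (p ^ r) * quadGauss (p ^ r) 1 := by
  have : Fact p.Prime := ⟨hp⟩
  have h2 : ¬ (p : ℤ) ∣ 2 * 1 := fun h => hu (by simpa using h.mul_right u)
  have hp2 : p ≠ 2 := by rintro rfl; simp at h2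
  have hu0 : (u : ZMod p) ≠ 0 := by
    rw [Ne, ZMod.intCast_zmod_eq_zero_iff_dvd]
    exact fun h => hu (h.mul_left 2)
  induction r using Nat.twoStepInduction with
  | zero => simp [quadGauss]
  | one => simp [quadGauss_prime p hp2 hu0, quadGauss_prime p hp2 (u := 1) (by simp)]
  | more r ih _ =>
    have hsq : jacobiSym u p ^ 2 = 1 := by
      rw [← jacobiSym.legendreSym.to_jacobiSym]
      exact legendreSym.sq_one p hu0
    rw [quadGauss_prime_pow_add_two hp hu, quadGauss_prime_pow_add_two hp h2, ih,
      jacobiSym.pow_right, jacobiSym.pow_right, pow_add, hsq]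
    push_cast
    ring

theorem quadGauss_prime_pow_one_pow_four {p : ℕ} (hp : p.Prime) (hp2 : p ≠ 2) (r : ℕ) :
    quadGauss (p ^ r) 1 ^ 4 = (p : ℂ) ^ (2 * r) := by
  have : Fact p.Prime := ⟨hp⟩
  induction r using Nat.twoStepInduction with
  | zero => simp [quadGauss, eq']
  | one =>
    simp [quadGauss_prime p hp2 (u := 1) (by simp), gaussSum_complexQuadraticChar_pow_four p hp2]
  | more r ih _ =>
    have h2 : ¬ (p : ℤ) ∣ 2 * 1 := by
      rw [mul_one]
      exact_mod_cast fun h => hp2 ((Nat.prime_dvd_prime_iff_eq hp Nat.prime_two).mp h)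
    rw [quadGauss_prime_pow_add_two hp h2, mul_pow, ih]
    ring

theorem sum_stdAddChar_quadratic {q : ℕ} [NeZero q] (u : ℤ) (c h : ZMod q)
    (hc : c = 2 * u * h) :
    ∑ x : ZMod q, ZMod.stdAddChar ((u : ZMod q) * x ^ 2 + x * c) =
      ZMod.stdAddChar (-((u : ZMod q) * h ^ 2)) * quadGauss q u := by
  rw [quadGauss_eq_sum_zmod, ← Equiv.sum_comp (Equiv.addRight h)
    (fun x => (ZMod.stdAddChar ((u : ZMod q) * x ^ 2) : ℂ)), mul_sum]
  refine sum_congr rfl fun x _ => ?_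
  rw [← AddChar.map_add_eq_mul, hc, Equiv.coe_addRight]
  congr 1
  ring

theorem stdAddChar_sum {q : ℕ} [NeZero q] {ι : Type*} (s : Finset ι) (f : ι → ZMod q) :
    (ZMod.stdAddChar (∑ i ∈ s, f i) : ℂ) = ∏ i ∈ s, ZMod.stdAddChar (f i) := by
  classical
  induction s using Finset.induction_on with
  | empty => simp
  | insert i s hi ih => rw [sum_insert hi, prod_insert hi, AddChar.map_add_eq_mul, ih]

theorem sum_piFinset_eq'_diagonal {q : ℕ} [NeZero q] (A c : Fin 4 → ℤ) (a : ℕ) :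
    ∑ b ∈ Fintype.piFinset (fun _ : Fin 4 => range q),
      eq' q ((a : ℤ) * (∑ i, A i * ((b i : ℤ)) ^ 2) + ∑ i, (b i : ℤ) * c i) =
    ∏ i, ∑ x : ZMod q,
      (ZMod.stdAddChar (((a * A i : ℤ) : ZMod q) * x ^ 2 + x * (c i : ZMod q)) : ℂ) := by
  simp only [← sum_range_natCast_zmod]
  rw [prod_univ_sum]
  refine sum_congr rfl fun b _ => ?_
  rw [mul_sum, ← sum_add_distrib, eq'_eq_stdAddChar, Int.cast_sum, stdAddChar_sum]
  refine prod_congr rfl fun i _ => ?_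
  congr 1
  push_cast
  ring

theorem stmt_7 (A c : Fin 4 → ℤ) (hA : ∀ i, A i ≠ 0) (p : ℕ) (hp : p.Prime)
    (hpd : ¬ ((p : ℤ) ∣ 2 * ∏ i, A i)) (r : ℕ) (hr : 1 ≤ r) :
    Sq A c (p ^ r) =
      (jacobiSym (∏ i, A i) (p ^ r) : ℂ) * (p : ℂ) ^ (2 * r) *
        ramanujanC (p ^ r) (∑ i, (∏ j ∈ Finset.univ.erase i, A j) * (c i) ^ 2) := by
  have hpZ : Prime (p : ℤ) := Nat.prime_iff_prime_int.mp hp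
  have : NeZero (p ^ r) := ⟨pow_ne_zero _ hp.ne_zero⟩
  have hp2 : p ≠ 2 := by rintro rfl; exact hpd (dvd_mul_right _ _)
  have unit_of_not_dvd {n : ℤ} (hn : ¬ (p : ℤ) ∣ n) : IsUnit (n : ZMod (p ^ r)) := by
    rw [ZMod.coe_int_isUnit_iff_isCoprime]
    push_cast
    exact ((hpZ.coprime_iff_not_dvd).mpr hn).pow_left
  have hAi (i : Fin 4) : ¬ (p : ℤ) ∣ 2 * A i := fun h =>
    hpd (h.trans (mul_dvd_mul_left 2 (dvd_prod_of_mem A (mem_univ i))))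
  set D : ℤ := ∏ i, A i with hD
  set N : ℤ := ∑ i, (∏ j ∈ Finset.univ.erase i, A j) * (c i) ^ 2 with hN
  have h4D : ¬ (p : ℤ) ∣ 4 * D := by
    intro h
    rw [show 4 * D = 2 * (2 * D) by ring] at h
    rcases hpZ.dvd_or_dvd h with h | h
    · exact hpd (h.mul_right D)
    · exact hpd h
  obtain ⟨w, hw⟩ := unit_of_not_dvd h4D
  have phase (a : ℕ) (ha : a.gcd (p ^ r) = 1) :
      ∑ b ∈ Fintype.piFinset (fun _ : Fin 4 => range (p ^ r)),
        eq' (p ^ r) ((a : ℤ) * (∑ i, A i * ((b i : ℤ)) ^ 2) + ∑ i, (b i : ℤ) * c i) =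
      (jacobiSym D (p ^ r) : ℂ) * (p : ℂ) ^ (2 * r) *
        ZMod.stdAddChar (-((w : ZMod (p ^ r))⁻¹ * (a : ZMod (p ^ r))⁻¹ * (N : ZMod (p ^ r)))) := by
    have hpa : ¬ (p : ℤ) ∣ a := by
      rw [Int.natCast_dvd_natCast, ← hp.coprime_iff_not_dvd]
      exact (Nat.Coprime.coprime_dvd_right (dvd_pow_self p (by omega)) ha).symm
    have haA (i : Fin 4) : ¬ (p : ℤ) ∣ 2 * (a * A i) := by
      rw [mul_left_comm]
      exact hpZ.not_dvd_mul hpa (hAi i)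
    have hsolve (i : Fin 4) :
        ∃ h : ZMod (p ^ r), (c i : ZMod (p ^ r)) = 2 * ((a * A i : ℤ) : ZMod (p ^ r)) * h := by
      obtain ⟨v, hv⟩ := unit_of_not_dvd (haA i)
      refine ⟨v⁻¹ * c i, ?_⟩
      rw [← mul_assoc, show (2 : ZMod (p ^ r)) * ((a * A i : ℤ) : ZMod (p ^ r)) = v by
        rw [hv]; push_cast; ring, Units.mul_inv, one_mul]
    choose h hh using hsolve
    rw [sum_piFinset_eq'_diagonal,
      prod_congr rfl fun i _ => sum_stdAddChar_quadratic (a * A i) _ (h i) (hh i),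
      prod_mul_distrib, ← stdAddChar_sum,
      prod_congr (f := fun i => quadGauss (p ^ r) (a * A i)) rfl
        fun i _ => quadGauss_prime_pow hp (haA i) r,
      prod_mul_distrib, prod_const, card_univ, Fintype.card_fin,
      quadGauss_prime_pow_one_pow_four hp hp2]
    have hjac : ∏ i, (jacobiSym (a * A i) (p ^ r) : ℂ) = jacobiSym D (p ^ r) := by
      have hsq : jacobiSym (a : ℤ) (p ^ r) ^ 2 = 1 :=
        jacobiSym.sq_one (by rwa [Int.gcd_natCast_natCast])
      simp only [jacobiSym.mul_left, hD, Fin.prod_univ_four]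
      push_cast
      have hsq' : (jacobiSym (a : ℤ) (p ^ r) : ℂ) ^ 2 = 1 := by exact_mod_cast hsq
      linear_combination ((jacobiSym (a : ℤ) (p ^ r) : ℂ) ^ 2 + 1) *
        (jacobiSym (A 0) (p ^ r) * jacobiSym (A 1) (p ^ r) * jacobiSym (A 2) (p ^ r) *
          jacobiSym (A 3) (p ^ r) : ℂ) * hsq'
    rw [hjac, mul_comm]
    congr 2
    obtain ⟨v, hv⟩ := unit_of_not_dvd hpa
    have hv' : (a : ZMod (p ^ r)) = v := by rw [hv]; simp
    have hNh : (N : ZMod (p ^ r)) = w * v * ∑ i, ((a * A i : ℤ) : ZMod (p ^ r)) * h i ^ 2 := by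
      rw [hw, hN, Int.cast_sum, mul_sum]
      refine sum_congr rfl fun i _ => ?_
      have hDi : D = A i * ∏ j ∈ univ.erase i, A j := (mul_prod_erase univ A (mem_univ i)).symm
      rw [Int.cast_mul, Int.cast_pow, hh, hDi, ← hv']
      push_cast
      ring
    rw [hNh, hv', sum_neg_distrib, ZMod.inv_coe_unit, ZMod.inv_coe_unit]
    congr 1
    rw [← mul_assoc, mul_mul_mul_comm, Units.inv_mul, Units.inv_mul, one_mul, one_mul]
  rw [Sq, sum_congr rfl fun a ha => phase a (mem_filter.mp ha).2, ← mul_sum, ramanujanC]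
  congr 1
  rw [sum_coprime_natCast_zmod (p ^ r) (fun x => (ZMod.stdAddChar
    (-((w : ZMod (p ^ r))⁻¹ * x⁻¹ * (N : ZMod (p ^ r)))) : ℂ))]
  simp only [eq'_eq_stdAddChar, Int.cast_mul, Int.cast_natCast]
  rw [sum_coprime_natCast_zmod (p ^ r) (fun x => (ZMod.stdAddChar (x * (N : ZMod (p ^ r))) : ℂ))]
  refine Fintype.sum_equiv ((Equiv.inv _).trans (Equiv.mulLeft (-w⁻¹))) _ _ fun u => ?_
  simp [ZMod.inv_coe_unit]
end
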